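/- Let β ∈ (0,1/4] and let H : [0,1] → [H̲,H̄] with 1/α < H̲ ≤ H̄ < 1 satisfy |H(t₁) − H(t₂)| ≤ c_H |t₁ − t₂|^{ρ_H} for all t₁,t₂ ∈ [0,1], where c_H > 0 and H̄ < ρ_H ≤ 1. For a compact interval I ⊆ [0,1] and integer N set S_N(I) = Σ_{k ∈ ν_N(I)} ‖Φ_α(·, H(k/N))‖_{L^α(ℝ)}^β N^{−β H(k/N)}, T_{2N}(I) = Σ_{m ∈ ν_{2N}(I)} ‖Φ_α(·, H(m/(2N)))‖_{L^α(ℝ)}^β (2N)^{−β H(m/(2N))}, H̲(I) = min_{t ∈ I} H(t), R_N(I) = (|ν_N(I)|/|ν_{2N}(I)|) · T_{2N}(I)/S_N(I), and T_N(μ,β) = min{ (log log N)/(log N), μ^{ρ_H} } + N^{−β ρ_H} (log N)³ + μ^{−1} N^{−1} (log N)² for μ ∈ (0,1]. Then there exist constants c, c', c'' > 0 (not depending on I and N) such that for every compact interval I ⊆ [0,1] and every integer N ≥ 4 with λ(I) ≥ 4(L+1) N^{−1} (log N)², one has: (i) |2^{β H̲(I)} · R_N(I) − 1| ≤ c ·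 T_N(λ(I),β); (ii) 1/(2^{β H̲(I)} · R_N(I)) ≤ c'; and (iii) |1/(2^{β H̲(I)} · R_N(I)) − 1| ≤ c'' · T_N(λ(I),β). -/

import Mathlib

open MeasureTheory
open scoped Classical

/-- `(x)_+^κ = x^κ` if `x > 0`, and `0` otherwise. -/
noncomputable def posPow (x κ : ℝ) : ℝ := if 0 < x then x ^ κ else 0

/-- `Φ_α(u,v) = Σ_{l=0}^L a_l (l−u)_+^{v−1/α}` with `a_l = (−1)^{L−l}·(L choose l)`. -/
noncomputable def Phi (α : ℝ) (L : ℕ) (u v : ℝ) : ℝ :=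
  ∑ l ∈ Finset.range (L + 1),
    ((-1 : ℝ) ^ (L - l) * (L.choose l : ℝ)) * posPow ((l : ℝ) - u) (v - 1 / α)

/-- `‖Φ_α(·,v)‖_{L^α(ℝ)} = (∫_ℝ |Φ_α(u,v)|^α du)^{1/α}`. -/
noncomputable def PhiNorm (α : ℝ) (L : ℕ) (v : ℝ) : ℝ :=
  (∫ u : ℝ, |Phi α L u v| ^ α) ^ (1 / α)

/-- The exponential comparison `|x^a - x^b| ≤ |a - b| |log x| (x^a + x^b)`. -/
lemma abs_rpow_sub_rpow_le {x : ℝ} (hx : 0 < x) (a b : ℝ) :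
    |x ^ a - x ^ b| ≤ |a - b| * (|Real.log x| * (x ^ a + x ^ b)) := by
  have key : ∀ p q : ℝ, |Real.exp p - Real.exp q| ≤ |p - q| * (Real.exp p + Real.exp q) := by
    have aux : ∀ p q : ℝ, Real.exp p - Real.exp q ≤ |p - q| * (Real.exp p + Real.exp q) := by
      intro p q
      have h1 := Real.add_one_le_exp (q - p)
      have h2 : Real.exp q = Real.exp p * Real.exp (q - p) := by
        rw [← Real.exp_add]; ring_nf
      have h3 := Real.exp_pos p
      have h4 := Real.exp_pos q
      have h5 : Real.exp p - Real.exp q ≤ (p - q) * Real.exp p := by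
        rw [h2]; nlinarith
      have h6 := le_abs_self (p - q)
      have h7 := abs_nonneg (p - q)
      nlinarith
    intro p q
    rw [abs_le]
    constructor
    · have := aux q p
      rw [abs_sub_comm] at this
      linarith
    · exact aux p q
  rw [Real.rpow_def_of_pos hx, Real.rpow_def_of_pos hx]
  refine (key _ _).trans (le_of_eq ?_)
  rw [← mul_sub, abs_mul]
  ring

/-- On a bounded range the map `κ ↦ x^κ` is Lipschitz uniformly in `x`, away from `κ = 0`. -/
lemma abs_rpow_sub_rpow_le_of_le {x X k₀ a b : ℝ} (hx : 0 < x) (hxX : x ≤ X)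
    (hk₀ : 0 < k₀) (ha : a ∈ Set.Icc k₀ 1) (hb : b ∈ Set.Icc k₀ 1) :
    |x ^ a - x ^ b| ≤ (2 / k₀ + 2 * X ^ 2) * |a - b| := by
  refine (abs_rpow_sub_rpow_le hx a b).trans ?_
  rw [mul_comm]
  refine mul_le_mul_of_nonneg_right ?_ (abs_nonneg _)
  have hk : (0 : ℝ) < 2 / k₀ := by positivity
  rcases le_total x 1 with h | h
  · have aux : ∀ c ∈ Set.Icc k₀ 1, |Real.log x| * x ^ c ≤ 1 / k₀ := by
      intro c hc
      have h1 := Real.abs_log_mul_self_rpow_lt x c hx h (hk₀.trans_le hc.1)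
      rw [abs_mul, abs_of_pos (Real.rpow_pos_of_pos hx c)] at h1
      exact h1.le.trans (one_div_le_one_div_of_le hk₀ hc.1)
    have h1 := aux a ha
    have h2 := aux b hb
    have : 2 / k₀ = 1 / k₀ + 1 / k₀ := by ring
    nlinarith [sq_nonneg X]
  · have aux : ∀ c ∈ Set.Icc k₀ 1, x ^ c ≤ X := by
      intro c hc
      calc x ^ c ≤ x ^ (1 : ℝ) := Real.rpow_le_rpow_of_exponent_le h hc.2
        _ ≤ X := by simpa using hxX
    have h1 := aux a ha
    have h2 := aux b hb
    have h3 : |Real.log x| ≤ X := by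
      rw [abs_of_nonneg (Real.log_nonneg h)]
      exact (Real.log_le_sub_one_of_pos hx).trans (by linarith)
    have : |Real.log x| * (x ^ a + x ^ b) ≤ X * (X + X) :=
      mul_le_mul h3 (by linarith) (by positivity) (by linarith)
    nlinarith

lemma abs_rpow_add_sub_rpow_le {s y a k : ℝ} (hs : 1 ≤ s) (hy : 0 ≤ y)
    (ha : a ∈ Set.Icc 0 1) (hak : a ≤ k) :
    |(s + y) ^ a - s ^ a| ≤ y * s ^ (k - 1) := by
  have h := Convex.norm_image_sub_le_of_norm_hasDerivWithin_le (f := fun x : ℝ => x ^ a)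
    (f' := fun x => a * x ^ (a - 1)) (C := s ^ (k - 1)) (s := Set.Icc s (s + y)) (x := s)
    (y := s + y) ?_ ?_ (convex_Icc _ _) (by simp [hy]) (by simp [hy])
  · simpa [abs_of_nonneg hy, mul_comm] using h
  · intro x hx
    exact (Real.hasDerivAt_rpow_const (Or.inl (by linarith [hx.1]))).hasDerivWithinAt
  · intro x hx
    have hx0 : 0 < x := by linarith [hx.1]
    rw [Real.norm_of_nonneg (mul_nonneg ha.1 (Real.rpow_nonneg hx0.le _))]
    calc a * x ^ (a - 1) ≤ 1 * x ^ (a - 1) :=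
          mul_le_mul_of_nonneg_right ha.2 (Real.rpow_nonneg hx0.le _)
      _ = x ^ (a - 1) := one_mul _
      _ ≤ s ^ (a - 1) := Real.rpow_le_rpow_of_nonpos (by linarith) hx.1 (by linarith [ha.2])
      _ ≤ s ^ (k - 1) := Real.rpow_le_rpow_of_exponent_le hs (by linarith)

lemma abs_rpow_add_sub_rpow_sub_le {s y a b k ε : ℝ} (hs : 1 ≤ s) (hy : 0 ≤ y) (hε : 0 < ε)
    (hb : b ∈ Set.Icc 0 1) (hak : a ≤ k) (hbk : b ≤ k)
    (hk : k + ε ≤ 1) :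
    |((s + y) ^ a - (s + y) ^ b) - (s ^ a - s ^ b)| ≤
      (1 + 2 / ε) * |a - b| * y * s ^ (k + ε - 1) := by
  have h := Convex.norm_image_sub_le_of_norm_hasDerivWithin_le (f := fun x : ℝ => x ^ a - x ^ b)
    (f' := fun x => a * x ^ (a - 1) - b * x ^ (b - 1))
    (C := (1 + 2 / ε) * |a - b| * s ^ (k + ε - 1)) (s := Set.Icc s (s + y)) (x := s)
    (y := s + y) ?_ ?_ (convex_Icc _ _) (by simp [hy]) (by simp [hy])
  · simp only [Real.norm_eq_abs, add_sub_cancel_left, abs_of_nonneg hy] at h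
    exact h.trans (le_of_eq (by ring))
  · intro x hx
    have hx0 : x ≠ 0 := by linarith [hx.1]
    exact ((Real.hasDerivAt_rpow_const (Or.inl hx0)).sub
      (Real.hasDerivAt_rpow_const (Or.inl hx0))).hasDerivWithinAt
  · intro x hx
    have hx1 : 1 ≤ x := hs.trans hx.1
    have hx0 : 0 < x := by linarith
    have hlog : 0 ≤ Real.log x := Real.log_nonneg hx1
    have e1 : |x ^ (a - 1) - x ^ (b - 1)| ≤ |a - b| * (Real.log x * (2 * x ^ (k - 1))) := by
      have h1 := abs_rpow_sub_rpow_le hx0 (a - 1) (b - 1)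
      rw [abs_of_nonneg hlog, sub_sub_sub_cancel_right] at h1
      refine h1.trans (mul_le_mul_of_nonneg_left (mul_le_mul_of_nonneg_left ?_ hlog)
        (abs_nonneg _))
      have h2 := Real.rpow_le_rpow_of_exponent_le hx1 (sub_le_sub_right hak 1)
      have h3 := Real.rpow_le_rpow_of_exponent_le hx1 (sub_le_sub_right hbk 1)
      linarith
    have e2 : Real.log x * x ^ (k - 1) ≤ x ^ (k + ε - 1) / ε := by
      have h1 := Real.log_le_rpow_div hx0.le hε
      calc Real.log x * x ^ (k - 1) ≤ x ^ ε / ε * x ^ (k - 1) :=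
            mul_le_mul_of_nonneg_right h1 (Real.rpow_nonneg hx0.le _)
        _ = x ^ (k + ε - 1) / ε := by
            rw [div_mul_eq_mul_div, ← Real.rpow_add hx0]; ring_nf
    have e3 : x ^ (a - 1) ≤ x ^ (k + ε - 1) :=
      Real.rpow_le_rpow_of_exponent_le hx1 (by linarith)
    have e4 : x ^ (k + ε - 1) ≤ s ^ (k + ε - 1) :=
      Real.rpow_le_rpow_of_nonpos (by linarith) hx.1 (by linarith)
    have e5 : a * x ^ (a - 1) - b * x ^ (b - 1) =
        (a - b) * x ^ (a - 1) + b * (x ^ (a - 1) - x ^ (b - 1)) := by ring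
    have e6 : 0 ≤ x ^ (a - 1) := Real.rpow_nonneg hx0.le _
    rw [Real.norm_eq_abs, e5]
    refine (abs_add_le _ _).trans ?_
    rw [abs_mul, abs_mul, abs_of_nonneg e6, abs_of_nonneg hb.1]
    have e7 : b * |x ^ (a - 1) - x ^ (b - 1)| ≤ |a - b| * (2 / ε * x ^ (k + ε - 1)) := by
      calc b * |x ^ (a - 1) - x ^ (b - 1)| ≤ 1 * |x ^ (a - 1) - x ^ (b - 1)| :=
            mul_le_mul_of_nonneg_right hb.2 (abs_nonneg _)
        _ = |x ^ (a - 1) - x ^ (b - 1)| := one_mul _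
        _ ≤ |a - b| * (Real.log x * (2 * x ^ (k - 1))) := e1
        _ ≤ |a - b| * (2 / ε * x ^ (k + ε - 1)) := by
            refine mul_le_mul_of_nonneg_left ?_ (abs_nonneg _)
            calc Real.log x * (2 * x ^ (k - 1)) = 2 * (Real.log x * x ^ (k - 1)) := by ring
              _ ≤ 2 * (x ^ (k + ε - 1) / ε) := by linarith
              _ = 2 / ε * x ^ (k + ε - 1) := by ring
    calc |a - b| * x ^ (a - 1) + b * |x ^ (a - 1) - x ^ (b - 1)|
        ≤ |a - b| * x ^ (k + ε - 1) + |a - b| * (2 / ε * x ^ (k + ε - 1)) :=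
          add_le_add (mul_le_mul_of_nonneg_left e3 (abs_nonneg _)) e7
      _ = (1 + 2 / ε) * |a - b| * x ^ (k + ε - 1) := by ring
      _ ≤ (1 + 2 / ε) * |a - b| * s ^ (k + ε - 1) :=
          mul_le_mul_of_nonneg_left e4 (by positivity)

lemma sum_alternating_choose_eq_zero {L : ℕ} (hL : L ≠ 0) :
    ∑ l ∈ Finset.range (L + 1), ((-1 : ℝ) ^ (L - l) * (L.choose l : ℝ)) = 0 := by
  have h := add_pow (1 : ℝ) (-1) L
  simp only [add_neg_cancel, one_pow, one_mul, zero_pow hL] at h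
  exact h.symm

lemma abs_sum_alternating_choose_mul_le {L : ℕ} {f : ℕ → ℝ} {B : ℝ}
    (hf : ∀ l ∈ Finset.range (L + 1), |f l| ≤ B) :
    |∑ l ∈ Finset.range (L + 1), ((-1 : ℝ) ^ (L - l) * (L.choose l : ℝ)) * f l| ≤ 2 ^ L * B := by
  refine (Finset.abs_sum_le_sum_abs _ _).trans ?_
  have h : (2 : ℝ) ^ L = ∑ l ∈ Finset.range (L + 1), (L.choose l : ℝ) := by
    exact_mod_cast (Nat.sum_range_choose L).symm
  rw [h, Finset.sum_mul]
  refine Finset.sum_le_sum fun l hl => ?_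
  rw [abs_mul, abs_mul, abs_pow, abs_neg, abs_one, one_pow, one_mul, Nat.abs_cast]
  exact mul_le_mul_of_nonneg_left (hf l hl) (Nat.cast_nonneg _)

/-- Decay of finite differences of a truncated function whose increments decay. -/
lemma abs_sum_truncated_le {L : ℕ} (hL : 1 ≤ L) {φ : ℝ → ℝ} {D D' γ : ℝ} (hγ : γ ∈ Set.Icc 0 1)
    (hD0 : 0 ≤ D) (hD0' : 0 ≤ D')
    (hD : ∀ x : ℝ, 0 < x → x ≤ L + 1 → |φ x| ≤ D)
    (hD' : ∀ s y : ℝ, 1 ≤ s → 0 ≤ y → y ≤ L → |φ (s + y) - φ s| ≤ D' * s ^ (-γ)) (u : ℝ) :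
    |∑ l ∈ Finset.range (L + 1), ((-1 : ℝ) ^ (L - l) * (L.choose l : ℝ)) *
        (if 0 < (l : ℝ) - u then φ ((l : ℝ) - u) else 0)| ≤
      2 ^ L * ((L + 1) * D + 2 * D') * (1 + |u|) ^ (-γ) := by
  have hL1 : (1 : ℝ) ≤ L := by exact_mod_cast hL
  have hr : 0 ≤ (1 + |u|) ^ (-γ) := by positivity
  have hl : ∀ l ∈ Finset.range (L + 1), (l : ℝ) ≤ L := fun l hl => by
    exact_mod_cast Nat.lt_succ_iff.1 (Finset.mem_range.1 hl)
  rw [mul_assoc]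
  rcases lt_or_ge (L : ℝ) u with h | h
  · refine abs_sum_alternating_choose_mul_le fun l hl' => ?_
    rw [if_neg (by linarith [hl l hl']), abs_zero]
    positivity
  rcases le_or_gt (-1) u with h' | h'
  · refine abs_sum_alternating_choose_mul_le fun l hl' => ?_
    have hu : 1 + |u| ≤ L + 1 := by
      have : |u| ≤ L := abs_le.2 ⟨by linarith, h⟩
      linarith
    have h1 : 1 ≤ (L + 1) * (1 + |u|) ^ (-γ) := by
      have h2 : (1 + |u|) ^ γ ≤ L + 1 := by
        calc (1 + |u|) ^ γ ≤ (1 + |u|) ^ (1 : ℝ) :=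
              Real.rpow_le_rpow_of_exponent_le (by linarith [abs_nonneg u]) hγ.2
          _ ≤ L + 1 := by simpa using hu
      have h3 : 0 < (1 + |u|) ^ γ := by positivity
      rw [Real.rpow_neg (by positivity), ← div_eq_mul_inv, one_le_div h3]
      exact h2
    have h4 : D ≤ ((L + 1) * D + 2 * D') * (1 + |u|) ^ (-γ) := by
      have : 0 ≤ D' * (1 + |u|) ^ (-γ) := by positivity
      nlinarith
    split_ifs with h5
    · exact (hD _ h5 (by linarith [hl l hl'])).trans h4
    · rw [abs_zero]; exact hD0.trans h4
  · have hs : 1 ≤ -u := by linarith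
    have e : ∀ l ∈ Finset.range (L + 1), ((-1 : ℝ) ^ (L - l) * (L.choose l : ℝ)) *
        (if 0 < (l : ℝ) - u then φ ((l : ℝ) - u) else 0) =
        ((-1 : ℝ) ^ (L - l) * (L.choose l : ℝ)) * (φ (-u + l) - φ (-u)) +
          ((-1 : ℝ) ^ (L - l) * (L.choose l : ℝ)) * φ (-u) := by
      intro l _
      rw [if_pos (by have : (0 : ℝ) ≤ l := Nat.cast_nonneg l; linarith),
        show (l : ℝ) - u = -u + l by ring]
      ring
    rw [Finset.sum_congr rfl e, Finset.sum_add_distrib, ← Finset.sum_mul,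
      sum_alternating_choose_eq_zero (by omega), zero_mul, add_zero]
    refine abs_sum_alternating_choose_mul_le fun l hl' => ?_
    refine (hD' _ _ hs (Nat.cast_nonneg l) (hl l hl')).trans ?_
    have h1 : (-u) ^ (-γ) ≤ 2 * (1 + |u|) ^ (-γ) := by
      have hu : |u| = -u := abs_of_neg (by linarith)
      have h2 : (2 * -u) ^ (-γ) ≤ (1 + |u|) ^ (-γ) :=
        Real.rpow_le_rpow_of_nonpos (by positivity) (by rw [hu]; linarith) (by linarith [hγ.1])
      rw [Real.mul_rpow (by norm_num) (by linarith)] at h2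
      have h3 : (2 : ℝ)⁻¹ ≤ (2 : ℝ) ^ (-γ) := by
        rw [← Real.rpow_neg_one]
        exact Real.rpow_le_rpow_of_exponent_le (by norm_num) (by linarith [hγ.2])
      have h4 : 0 ≤ (-u) ^ (-γ) := Real.rpow_nonneg (by linarith) _
      nlinarith
    have h5 : 0 ≤ (L + 1) * D * (1 + |u|) ^ (-γ) := by positivity
    nlinarith

lemma exists_Phi_bounds {α : ℝ} {L : ℕ} (hL : 1 ≤ L) {k₀ k ε : ℝ} (hk₀ : 0 < k₀) (hk : k₀ ≤ k)
    (hε : 0 < ε) (hkε : k + ε ≤ 1) :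
    ∃ C > 0, ∀ v v' : ℝ, v - 1 / α ∈ Set.Icc k₀ k → v' - 1 / α ∈ Set.Icc k₀ k → ∀ u : ℝ,
      |Phi α L u v| ≤ C * (1 + |u|) ^ (-(1 - k - ε)) ∧
      |Phi α L u v - Phi α L u v'| ≤ C * |v - v'| * (1 + |u|) ^ (-(1 - k - ε)) := by
  set γ := 1 - k - ε with hγ_def
  have hγ : γ ∈ Set.Icc 0 1 := ⟨by linarith, by linarith⟩
  set K : ℝ := 2 / k₀ + 2 * ((L : ℝ) + 1) ^ 2 with hK_def
  have hK : 0 < K := by positivity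
  set C₁ : ℝ := 2 ^ L * ((L + 1) * (L + 1) + 2 * L)
  set C₂ : ℝ := 2 ^ L * ((L + 1) * K + 2 * ((1 + 2 / ε) * L))
  have hC₁ : 0 < C₁ := by positivity
  have hC₂ : 0 < C₂ := by positivity
  refine ⟨C₁ + C₂, by positivity, fun v v' hv hv' u => ?_⟩
  have hr : 0 ≤ (1 + |u|) ^ (-γ) := by positivity
  have hv1 : v - 1 / α ∈ Set.Icc k₀ 1 := ⟨hv.1, by linarith [hv.2]⟩
  have hv1' : v' - 1 / α ∈ Set.Icc k₀ 1 := ⟨hv'.1, by linarith [hv'.2]⟩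
  constructor
  · have h := abs_sum_truncated_le hL (φ := fun x => x ^ (v - 1 / α)) (D := L + 1) (D' := L) hγ
      (by positivity) (by positivity) ?_ ?_ u
    · refine (h.trans ?_ : |Phi α L u v| ≤ _)
      exact mul_le_mul_of_nonneg_right (by linarith) hr
    · intro x hx hxL
      rw [abs_of_nonneg (Real.rpow_nonneg hx.le _)]
      calc x ^ (v - 1 / α) ≤ ((L : ℝ) + 1) ^ (v - 1 / α) :=
            Real.rpow_le_rpow hx.le hxL (by linarith [hv.1])
        _ ≤ ((L : ℝ) + 1) ^ (1 : ℝ) :=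
            Real.rpow_le_rpow_of_exponent_le (by linarith [(Nat.cast_nonneg L : (0 : ℝ) ≤ L)])
              hv1.2
        _ = L + 1 := Real.rpow_one _
    · intro s y hs hy hyL
      refine (abs_rpow_add_sub_rpow_le hs hy ⟨hk₀.le.trans hv1.1, hv1.2⟩
        (k := k + ε) (by linarith [hv.2])).trans ?_
      rw [show k + ε - 1 = -γ by rw [hγ_def]; ring]
      exact mul_le_mul_of_nonneg_right hyL (Real.rpow_nonneg (by linarith) _)
  · have h := abs_sum_truncated_le hL (φ := fun x => x ^ (v - 1 / α) - x ^ (v' - 1 / α))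
      (D := K * |v - v'|) (D' := (1 + 2 / ε) * |v - v'| * L) hγ
      (by positivity) (by positivity) ?_ ?_ u
    · have e : Phi α L u v - Phi α L u v' = ∑ l ∈ Finset.range (L + 1),
          ((-1 : ℝ) ^ (L - l) * (L.choose l : ℝ)) * (if 0 < (l : ℝ) - u then
            ((l : ℝ) - u) ^ (v - 1 / α) - ((l : ℝ) - u) ^ (v' - 1 / α) else 0) := by
        rw [Phi, Phi, ← Finset.sum_sub_distrib]
        refine Finset.sum_congr rfl fun l _ => ?_
        unfold posPow
        split_ifs <;> ring
      rw [e]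
      refine h.trans (mul_le_mul_of_nonneg_right ?_ hr)
      have : 0 ≤ C₁ * |v - v'| := by positivity
      calc _ = C₂ * |v - v'| := by ring
        _ ≤ _ := by linarith
    · intro x hx hxL
      have := abs_rpow_sub_rpow_le_of_le hx hxL hk₀ hv1 hv1'
      rwa [sub_sub_sub_cancel_right] at this
    · intro s y hs hy hyL
      have := abs_rpow_add_sub_rpow_sub_le hs hy hε
        ⟨hk₀.le.trans hv1'.1, hv1'.2⟩ hv.2 hv'.2 hkε
      rw [sub_sub_sub_cancel_right, show k + ε - 1 = -γ by rw [hγ_def]; ring] at this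
      refine this.trans (mul_le_mul_of_nonneg_right ?_ (Real.rpow_nonneg (by linarith) _))
      exact mul_le_mul_of_nonneg_left hyL (by positivity)

lemma measurable_Phi (α : ℝ) (L : ℕ) (v : ℝ) : Measurable fun u => Phi α L u v := by
  unfold Phi posPow
  refine Finset.measurable_fun_sum _ fun l _ => Measurable.const_mul ?_ _
  exact Measurable.ite (measurableSet_lt measurable_const (by fun_prop)) (by fun_prop)
    measurable_const

lemma abs_rpow_sub_rpow_le_of_one_le {p B x y : ℝ} (hp : 1 ≤ p) (hx : x ∈ Set.Icc 0 B)
    (hy : y ∈ Set.Icc 0 B) : |x ^ p - y ^ p| ≤ p * B ^ (p - 1) * |x - y| := by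
  have h := Convex.norm_image_sub_le_of_norm_hasDerivWithin_le (f := fun x : ℝ => x ^ p)
    (f' := fun x => p * x ^ (p - 1)) (C := p * B ^ (p - 1)) (s := Set.Icc 0 B) (x := y)
    (y := x) ?_ ?_ (convex_Icc _ _) hy hx
  · exact h
  · intro x _
    exact (Real.hasDerivAt_rpow_const (Or.inr hp)).hasDerivWithinAt
  · intro x hx
    rw [Real.norm_of_nonneg (mul_nonneg (by linarith) (Real.rpow_nonneg hx.1 _))]
    exact mul_le_mul_of_nonneg_left (Real.rpow_le_rpow hx.1 hx.2 (by linarith)) (by linarith)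

lemma abs_rpow_sub_rpow_le_of_le_one {p m x y : ℝ} (hp : p ∈ Set.Icc 0 1) (hm : 0 < m)
    (hx : m ≤ x) (hy : m ≤ y) : |x ^ p - y ^ p| ≤ m ^ (p - 1) * |x - y| := by
  have h := Convex.norm_image_sub_le_of_norm_hasDerivWithin_le (f := fun x : ℝ => x ^ p)
    (f' := fun x => p * x ^ (p - 1)) (C := m ^ (p - 1)) (s := Set.Ici m) (x := y)
    (y := x) ?_ ?_ (convex_Ici _) hy hx
  · exact h
  · intro x hx
    exact (Real.hasDerivAt_rpow_const (Or.inl (hm.trans_le hx).ne')).hasDerivWithinAt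
  · intro x hx
    have hx0 : 0 < x := hm.trans_le hx
    rw [Real.norm_of_nonneg (mul_nonneg hp.1 (Real.rpow_nonneg hx0.le _))]
    calc p * x ^ (p - 1) ≤ 1 * x ^ (p - 1) :=
          mul_le_mul_of_nonneg_right hp.2 (Real.rpow_nonneg hx0.le _)
      _ = x ^ (p - 1) := one_mul _
      _ ≤ m ^ (p - 1) := Real.rpow_le_rpow_of_nonpos hm hx (by linarith [hp.2])

lemma Phi_eq_of_mem {α : ℝ} {L : ℕ} {u v : ℝ} (hu : u ∈ Set.Ico ((L : ℝ) - 1) L) :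
    Phi α L u v = ((L : ℝ) - u) ^ (v - 1 / α) := by
  rw [Phi, Finset.sum_range_succ, Finset.sum_eq_zero]
  · simp [posPow, hu.2]
  · intro l hl
    have h : (l : ℝ) + 1 ≤ L := by exact_mod_cast Finset.mem_range.1 hl
    rw [posPow, if_neg (by linarith [hu.1]), mul_zero]

/-- The `β`-th power of the norm is bounded, bounded below and Lipschitz in the Hurst parameter. -/
lemma exists_PhiNorm_rpow_bounds {α : ℝ} (hα : 1 < α) {L : ℕ} (hL : 1 ≤ L) {β : ℝ}
    (hβ : β ∈ Set.Icc 0 1) {a b : ℝ} (ha : 1 / α < a) (hab : a ≤ b) (hb : b < 1) :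
    ∃ m > 0, ∃ M > 0, ∃ Λ > 0, ∀ v ∈ Set.Icc a b, ∀ v' ∈ Set.Icc a b,
      m ≤ PhiNorm α L v ^ β ∧ PhiNorm α L v ^ β ≤ M ∧
      |PhiNorm α L v ^ β - PhiNorm α L v' ^ β| ≤ Λ * |v - v'| := by
  have hα0 : 0 < α := by linarith
  have hαi : 0 < 1 / α := by positivity
  obtain ⟨C, hC, hΦ⟩ := exists_Phi_bounds (α := α) hL (k₀ := a - 1 / α) (k := b - 1 / α)
    (ε := (1 - b) / 2) (by linarith) (by linarith) (by linarith) (by linarith)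
  set γ := 1 - (b - 1 / α) - (1 - b) / 2 with hγ
  have hαγ : 1 < α * γ := by
    have : α * γ = 1 + α * ((1 - b) / 2) := by rw [hγ]; field_simp; ring
    nlinarith
  set r : ℝ → ℝ := fun u => (1 + |u|) ^ (-(α * γ)) with hr
  have hr_int : Integrable r := by
    have := integrable_one_add_norm (E := ℝ) (μ := volume) (r := α * γ) (by simpa using hαγ)
    simpa [hr, Real.norm_eq_abs] using this
  have hr_nonneg : ∀ u, 0 ≤ r u := fun u => by positivity
  have hr_eq : ∀ u : ℝ, (C * (1 + |u|) ^ (-γ)) ^ α = C ^ α * r u := by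
    intro u
    rw [Real.mul_rpow hC.le (by positivity), ← Real.rpow_mul (by positivity), hr]
    ring_nf
  set Q := ∫ u, r u with hQ
  have hQ0 : 0 ≤ Q := integral_nonneg hr_nonneg
  have hmem : ∀ v ∈ Set.Icc a b, v - 1 / α ∈ Set.Icc (a - 1 / α) (b - 1 / α) :=
    fun v hv => ⟨by linarith [hv.1], by linarith [hv.2]⟩
  have hle : ∀ v ∈ Set.Icc a b, ∀ u, |Phi α L u v| ^ α ≤ C ^ α * r u := by
    intro v hv u
    rw [← hr_eq]
    exact Real.rpow_le_rpow (abs_nonneg _) (hΦ v v (hmem v hv) (hmem v hv) u).1 hα0.le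
  have hint : ∀ v ∈ Set.Icc a b, Integrable fun u => |Phi α L u v| ^ α := by
    intro v hv
    refine (hr_int.const_mul (C ^ α)).mono' ?_ (Filter.Eventually.of_forall fun u => ?_)
    · exact ((measurable_Phi α L v).abs.pow_const α).aestronglyMeasurable
    · rw [Real.norm_of_nonneg (by positivity)]
      exact hle v hv u
  set J : ℝ → ℝ := fun v => ∫ u, |Phi α L u v| ^ α with hJ
  have hJle : ∀ v ∈ Set.Icc a b, J v ≤ C ^ α * Q := by
    intro v hv
    rw [hQ, ← integral_const_mul]
    exact integral_mono (hint v hv) (hr_int.const_mul _) (hle v hv)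
  set m : ℝ := (1 / 2) ^ α * (1 / 2) with hm
  have hm0 : 0 < m := by positivity
  have hJge : ∀ v ∈ Set.Icc a b, m ≤ J v := by
    intro v hv
    have h1 : ∫ u in Set.Ico ((L : ℝ) - 1) (L - 1 / 2), (1 / 2 : ℝ) ^ α = m := by
      rw [setIntegral_const, smul_eq_mul, Measure.real, Real.volume_Ico,
        ENNReal.toReal_ofReal (by linarith), hm]
      ring
    rw [← h1]
    refine le_trans (setIntegral_mono_on (integrableOn_const (by simp))
      (hint v hv).integrableOn measurableSet_Ico fun u hu => ?_)
      (setIntegral_le_integral (hint v hv) (Filter.Eventually.of_forall fun u => by positivity))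
    refine Real.rpow_le_rpow (by norm_num) ?_ hα0.le
    rw [Phi_eq_of_mem ⟨hu.1, by linarith [hu.2]⟩]
    refine le_trans ?_ (le_abs_self _)
    calc (1 / 2 : ℝ) = (1 / 2 : ℝ) ^ (1 : ℝ) := (Real.rpow_one _).symm
      _ ≤ (1 / 2 : ℝ) ^ (v - 1 / α) :=
          Real.rpow_le_rpow_of_exponent_ge (by norm_num) (by norm_num) (by linarith [hv.2])
      _ ≤ _ := Real.rpow_le_rpow (by norm_num) (by linarith [hu.2]) (by linarith [hv.1])
  have hJlip : ∀ v ∈ Set.Icc a b, ∀ v' ∈ Set.Icc a b,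
      |J v - J v'| ≤ α * C ^ α * Q * |v - v'| := by
    intro v hv v' hv'
    rw [hJ]
    simp only
    rw [← integral_sub (hint v hv) (hint v' hv')]
    refine (abs_integral_le_integral_abs).trans ?_
    rw [show α * C ^ α * Q * |v - v'| = ∫ u, α * C ^ α * |v - v'| * r u by
      rw [integral_const_mul]; ring]
    refine integral_mono ((hint v hv).sub (hint v' hv')).abs (hr_int.const_mul _) fun u => ?_
    have hB : 0 < C * (1 + |u|) ^ (-γ) := by positivity
    have h1 := hΦ v v' (hmem v hv) (hmem v' hv') u
    have h2 := hΦ v' v (hmem v' hv') (hmem v hv) u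
    refine (abs_rpow_sub_rpow_le_of_one_le hα.le ⟨abs_nonneg _, h1.1⟩
      ⟨abs_nonneg _, h2.1⟩).trans ?_
    calc α * (C * (1 + |u|) ^ (-γ)) ^ (α - 1) * |(|Phi α L u v| - |Phi α L u v'|)|
        ≤ α * (C * (1 + |u|) ^ (-γ)) ^ (α - 1) * (C * |v - v'| * (1 + |u|) ^ (-γ)) :=
          mul_le_mul_of_nonneg_left ((abs_abs_sub_abs_le_abs_sub _ _).trans h1.2)
            (by positivity)
      _ = α * ((C * (1 + |u|) ^ (-γ)) ^ (α - 1) * (C * (1 + |u|) ^ (-γ)) ^ (1 : ℝ)) *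
            |v - v'| := by rw [Real.rpow_one]; ring
      _ = α * C ^ α * |v - v'| * r u := by
          rw [← Real.rpow_add hB, sub_add_cancel, hr_eq]; ring
  have hβα : β / α ∈ Set.Icc (0 : ℝ) 1 :=
    ⟨div_nonneg hβ.1 hα0.le, (div_le_one hα0).2 (hβ.2.trans hα.le)⟩
  have hpow : ∀ v ∈ Set.Icc a b, PhiNorm α L v ^ β = J v ^ (β / α) := by
    intro v hv
    rw [PhiNorm, ← Real.rpow_mul (hm0.le.trans (hJge v hv)), one_div, inv_mul_eq_div]
  refine ⟨m ^ (β / α), by positivity, (C ^ α * Q) ^ (β / α) + 1, by positivity,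
    m ^ (β / α - 1) * (α * C ^ α * Q) + 1, by positivity, fun v hv v' hv' => ?_⟩
  rw [hpow v hv, hpow v' hv']
  refine ⟨Real.rpow_le_rpow hm0.le (hJge v hv) hβα.1, ?_, ?_⟩
  · have := Real.rpow_le_rpow (hm0.le.trans (hJge v hv)) (hJle v hv) hβα.1
    linarith
  · refine (abs_rpow_sub_rpow_le_of_le_one hβα hm0 (hJge v hv) (hJge v' hv')).trans ?_
    have := mul_le_mul_of_nonneg_left (hJlip v hv v' hv')
      (show 0 ≤ m ^ (β / α - 1) by positivity)
    nlinarith [abs_nonneg (v - v')]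

lemma sub_le_card_lattice {N L : ℕ} (hN : 0 < N) {ν : Finset ℕ} {a b : ℝ} (ha : 0 ≤ a)
    (hν : ∀ k : ℕ, k + L ≤ N → (k : ℝ) / N ∈ Set.Icc a b → k ∈ ν) (hb : b ≤ 1) :
    (N : ℝ) * (b - a) - L - 1 ≤ ν.card := by
  have hN0 : (0 : ℝ) < N := by exact_mod_cast hN
  rcases lt_or_ge (b * N - L) 0 with h | h
  · have : 0 ≤ a * N := by positivity
    have h2 : (0 : ℝ) ≤ ν.card := Nat.cast_nonneg _
    nlinarith
  have hsub : Finset.Icc ⌈a * N⌉₊ ⌊b * N - L⌋₊ ⊆ ν := by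
    intro k hk
    rw [Finset.mem_Icc] at hk
    have h1 : a * N ≤ k := Nat.ceil_le.1 hk.1
    have h2 : (k : ℝ) ≤ b * N - L := (Nat.le_floor_iff h).1 hk.2
    have hL : (0 : ℝ) ≤ L := Nat.cast_nonneg L
    refine hν k ?_ ⟨(le_div_iff₀ hN0).2 h1, (div_le_iff₀ hN0).2 (by linarith)⟩
    have : (k : ℝ) + L ≤ N := by nlinarith
    exact_mod_cast this
  have hcard := Finset.card_le_card hsub
  rw [Nat.card_Icc] at hcard
  have h1 := Nat.ceil_lt_add_one (show 0 ≤ a * N by positivity)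
  have h2 := Nat.lt_floor_add_one (b * N - L)
  have h3 : ⌊b * N - L⌋₊ + 1 ≤ ν.card + ⌈a * N⌉₊ := by omega
  have h4 : ((⌊b * N - L⌋₊ : ℕ) : ℝ) + 1 ≤ ν.card + (⌈a * N⌉₊ : ℕ) := by exact_mod_cast h3
  nlinarith

lemma card_lattice_le {N : ℕ} (hN : 0 < N) {ν : Finset ℕ} {u w : ℝ} (hu : 0 ≤ u) (huw : u ≤ w)
    (hν : ∀ k ∈ ν, (k : ℝ) / N ∈ Set.Icc u w) : (ν.card : ℝ) ≤ N * (w - u) + 1 := by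
  have hN0 : (0 : ℝ) < N := by exact_mod_cast hN
  have hw : 0 ≤ w * N := mul_nonneg (hu.trans huw) hN0.le
  have hsub : ν ⊆ Finset.Icc ⌈u * N⌉₊ ⌊w * N⌋₊ := by
    intro k hk
    have h := hν k hk
    rw [Finset.mem_Icc, Nat.ceil_le, Nat.le_floor_iff hw]
    exact ⟨(le_div_iff₀ hN0).1 h.1, (div_le_iff₀ hN0).1 h.2⟩
  have hcard := Finset.card_le_card hsub
  rw [Nat.card_Icc] at hcard
  rcases le_total ⌈u * N⌉₊ (⌊w * N⌋₊ + 1) with h | h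
  · have h3 : ν.card + ⌈u * N⌉₊ ≤ ⌊w * N⌋₊ + 1 := by omega
    have h4 : (ν.card : ℝ) + (⌈u * N⌉₊ : ℕ) ≤ (⌊w * N⌋₊ : ℕ) + 1 := by exact_mod_cast h3
    have h1 := Nat.le_ceil (u * N)
    have h2 := Nat.floor_le hw
    nlinarith
  · have h3 : ν.card = 0 := by omega
    rw [h3]
    have : 0 ≤ (N : ℝ) * (w - u) := mul_nonneg hN0.le (by linarith)
    push_cast
    linarith

/-- Comparison of a sum over the refined lattice of mesh `1/(2N)` with twice a sum over the lattice
of mesh `1/N`. -/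
lemma abs_sum_refined_sub_two_mul_sum_le {N L : ℕ} (hN : 0 < N) (hL : 1 ≤ L) {ν ν₂ : Finset ℕ}
    {u w : ℝ} (hu : 0 ≤ u) (huw : u ≤ w)
    (hν : ∀ k : ℕ, k ∈ ν ↔ k + L ≤ N ∧ (k : ℝ) / N ∈ Set.Icc u w)
    (hν₂ : ∀ m : ℕ, m ∈ ν₂ ↔ m + L ≤ 2 * N ∧ (m : ℝ) / (2 * N) ∈ Set.Icc u w)
    {p q : ℕ → ℝ} {B D : ℝ} (hD : 0 ≤ D)
    (hp : ∀ m ∈ ν₂, |p m| ≤ B) (hq : ∀ k ∈ ν, |q k| ≤ B) (hB : 0 ≤ B)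
    (hpq : ∀ m ∈ ν₂, m / 2 ∈ ν → |p m - q (m / 2)| ≤ D) :
    |∑ m ∈ ν₂, p m - 2 * ∑ k ∈ ν, q k| ≤ (L + 3) * B + 2 * ν.card * D := by
  have hN0 : (0 : ℝ) < N := by exact_mod_cast hN
  set E₀ := ν.image fun k => 2 * k
  set E₁ := ν.image fun k => 2 * k + 1
  have hdisj : Disjoint E₀ E₁ := by
    rw [Finset.disjoint_left]
    intro m h0 h1
    obtain ⟨a, -, rfl⟩ := Finset.mem_image.1 h0
    obtain ⟨b, -, hb⟩ := Finset.mem_image.1 h1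
    omega
  set E := E₀ ∪ E₁ with hE
  have hmemE : ∀ m, m ∈ E ↔ m / 2 ∈ ν := by
    intro m
    simp only [hE, E₀, E₁, Finset.mem_union, Finset.mem_image]
    constructor
    · rintro (⟨a, ha, rfl⟩ | ⟨a, ha, rfl⟩)
      · rwa [Nat.mul_div_cancel_left _ (by norm_num)]
      · rwa [show (2 * a + 1) / 2 = a by omega]
    · intro h
      rcases Nat.even_or_odd' m with ⟨c, rfl | rfl⟩
      · left; exact ⟨_, h, by omega⟩
      · right; exact ⟨_, h, by omega⟩
  have hEsum : ∑ m ∈ E, q (m / 2) = 2 * ∑ k ∈ ν, q k := by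
    rw [hE, Finset.sum_union hdisj, Finset.sum_image (by intro a _ b _ h; simpa using h),
      Finset.sum_image (by intro a _ b _ h; simpa using h), two_mul]
    congr 1
    · exact Finset.sum_congr rfl fun k _ => by rw [Nat.mul_div_cancel_left _ (by norm_num)]
    · exact Finset.sum_congr rfl fun k _ => by rw [show (2 * k + 1) / 2 = k by omega]
  have hEcard : (E ∩ ν₂).card ≤ 2 * ν.card := by
    refine (Finset.card_le_card Finset.inter_subset_left).trans
      ((Finset.card_union_le _ _).trans ?_)
    have h0 : E₀.card ≤ ν.card := Finset.card_image_le
    have h1 : E₁.card ≤ ν.card := Finset.card_image_le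
    omega
  have hout : (E \ ν₂).card ≤ 1 := by
    have : E \ ν₂ ⊆ {⌊w * (2 * N)⌋₊ + 1} := by
      intro m hm
      rw [Finset.mem_sdiff, hmemE, hν, hν₂] at hm
      obtain ⟨⟨h1, h2⟩, h3⟩ := hm
      have hm2 : ((m / 2 : ℕ) : ℝ) * 2 ≤ m := by exact_mod_cast Nat.div_mul_le_self m 2
      have hm2' : (m : ℝ) ≤ ((m / 2 : ℕ) : ℝ) * 2 + 1 := by
        exact_mod_cast (show m ≤ m / 2 * 2 + 1 by omega)
      have h4 := (le_div_iff₀ hN0).1 h2.1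
      have h5 := (div_le_iff₀ hN0).1 h2.2
      have h6 : ¬ (m : ℝ) ≤ w * (2 * N) := fun h => h3 ⟨by omega,
        (le_div_iff₀ (by positivity)).2 (by linarith), (div_le_iff₀ (by positivity)).2 h⟩
      rw [Finset.mem_singleton]
      have hw0 : 0 ≤ w * (2 * N) := mul_nonneg (hu.trans huw) (by positivity)
      have h7 : ⌊w * (2 * N)⌋₊ < m := (Nat.floor_lt hw0).2 (not_le.1 h6)
      have h8 : m - 1 ≤ ⌊w * (2 * N)⌋₊ := by
        refine Nat.le_floor ?_
        rw [Nat.cast_sub (by omega)]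
        push_cast
        linarith
      omega
    exact (Finset.card_le_card this).trans (by simp)
  have hin : (ν₂ \ E).card ≤ L + 2 := by
    have : ν₂ \ E ⊆ insert ⌈u * (2 * N)⌉₊ (Finset.Icc (2 * N - 2 * L) (2 * N - L)) := by
      intro m hm
      rw [Finset.mem_sdiff, hmemE, hν, hν₂] at hm
      obtain ⟨⟨h1, h2⟩, h3⟩ := hm
      rw [Finset.mem_insert, Finset.mem_Icc]
      by_cases h4 : m / 2 + L ≤ N
      · left
        have hm2 : ((m / 2 : ℕ) : ℝ) * 2 ≤ m := by exact_mod_cast Nat.div_mul_le_self m 2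
        have hm2' : (m : ℝ) ≤ ((m / 2 : ℕ) : ℝ) * 2 + 1 := by
          exact_mod_cast (show m ≤ m / 2 * 2 + 1 by omega)
        have h5 := (le_div_iff₀ (by positivity)).1 h2.1
        have h6 := (div_le_iff₀ (by positivity)).1 h2.2
        have h7 : ¬ u * N ≤ ((m / 2 : ℕ) : ℝ) := fun h => h3 ⟨h4,
          (le_div_iff₀ hN0).2 h, (div_le_iff₀ hN0).2 (by linarith)⟩
        have h8 := Nat.ceil_le.2 h5
        have h9 : (m : ℝ) < (⌈u * (2 * N)⌉₊ : ℕ) + 1 := by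
          linarith [Nat.le_ceil (u * (2 * N))]
        have h10 : m < ⌈u * (2 * N)⌉₊ + 1 := by exact_mod_cast h9
        omega
      · right; omega
    refine (Finset.card_le_card this).trans ((Finset.card_insert_le _ _).trans ?_)
    rw [Nat.card_Icc]
    omega
  have e1 : ∑ m ∈ ν₂, p m = ∑ m ∈ E ∩ ν₂, p m + ∑ m ∈ ν₂ \ E, p m := by
    rw [Finset.inter_comm, Finset.sum_inter_add_sum_sdiff]
  have e2 : 2 * ∑ k ∈ ν, q k = ∑ m ∈ E ∩ ν₂, q (m / 2) + ∑ m ∈ E \ ν₂, q (m / 2) := by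
    rw [← hEsum, Finset.sum_inter_add_sum_sdiff]
  have b1 : |∑ m ∈ E ∩ ν₂, p m - ∑ m ∈ E ∩ ν₂, q (m / 2)| ≤ 2 * ν.card * D := by
    rw [← Finset.sum_sub_distrib]
    refine (Finset.abs_sum_le_sum_abs _ _).trans ?_
    refine (Finset.sum_le_card_nsmul _ _ D fun m hm => ?_).trans ?_
    · rw [Finset.mem_inter, hmemE] at hm
      exact hpq m hm.2 hm.1
    · rw [nsmul_eq_mul]
      exact mul_le_mul_of_nonneg_right (by exact_mod_cast hEcard) hD
  have b2 : |∑ m ∈ ν₂ \ E, p m| ≤ (L + 2) * B := by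
    refine (Finset.abs_sum_le_sum_abs _ _).trans ?_
    refine (Finset.sum_le_card_nsmul _ _ B fun m hm => hp m (Finset.mem_sdiff.1 hm).1).trans ?_
    rw [nsmul_eq_mul]
    exact mul_le_mul_of_nonneg_right (by exact_mod_cast hin) hB
  have b3 : |∑ m ∈ E \ ν₂, q (m / 2)| ≤ B := by
    refine (Finset.abs_sum_le_sum_abs _ _).trans ?_
    refine (Finset.sum_le_card_nsmul _ _ B fun m hm =>
      hq _ ((hmemE m).1 (Finset.mem_sdiff.1 hm).1)).trans ?_
    rw [nsmul_eq_mul]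
    exact mul_le_of_le_one_left hB (by exact_mod_cast hout)
  rw [e1, e2]
  rw [abs_le] at b1 b2 b3 ⊢
  constructor <;> linarith [b1.1, b1.2, b2.1, b2.2, b3.1, b3.2]

lemma two_mul_mem_refined {N L : ℕ} {ν ν₂ : Finset ℕ} {u w : ℝ}
    (hν : ∀ k : ℕ, k ∈ ν ↔ k + L ≤ N ∧ (k : ℝ) / N ∈ Set.Icc u w)
    (hν₂ : ∀ m : ℕ, m ∈ ν₂ ↔ m + L ≤ 2 * N ∧ (m : ℝ) / (2 * N) ∈ Set.Icc u w) {k : ℕ}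
    (hk : k ∈ ν) : 2 * k ∈ ν₂ := by
  rw [hν] at hk
  rw [hν₂]
  refine ⟨by omega, ?_⟩
  push_cast
  rw [mul_div_mul_left _ _ (by norm_num)]
  exact hk.2

lemma sum_le_sum_refined {N L : ℕ} {ν ν₂ : Finset ℕ} {u w : ℝ}
    (hν : ∀ k : ℕ, k ∈ ν ↔ k + L ≤ N ∧ (k : ℝ) / N ∈ Set.Icc u w)
    (hν₂ : ∀ m : ℕ, m ∈ ν₂ ↔ m + L ≤ 2 * N ∧ (m : ℝ) / (2 * N) ∈ Set.Icc u w)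
    {f : ℝ → ℝ} (hf : ∀ t ∈ Set.Icc u w, 0 ≤ f t) :
    ∑ k ∈ ν, f ((k : ℝ) / N) ≤ ∑ m ∈ ν₂, f ((m : ℝ) / (2 * N)) := by
  have h : ∑ m ∈ ν.image (fun k : ℕ => 2 * k), f ((m : ℝ) / (2 * N)) =
      ∑ k ∈ ν, f ((k : ℝ) / N) := by
    rw [Finset.sum_image (by intro a _ b _ h; simpa using h)]
    refine Finset.sum_congr rfl fun k _ => ?_
    push_cast
    rw [mul_div_mul_left _ _ (by norm_num)]
  rw [← h]
  refine Finset.sum_le_sum_of_subset_of_nonneg ?_ fun m hm _ => hf _ ((hν₂ m).1 hm).2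
  intro m hm
  obtain ⟨k, hk, rfl⟩ := Finset.mem_image.1 hm
  exact two_mul_mem_refined hν hν₂ hk

lemma one_le_log_natCast {N : ℕ} (hN : 4 ≤ N) : 1 ≤ Real.log N := by
  rw [Real.le_log_iff_exp_le (by positivity)]
  have h : (4 : ℝ) ≤ N := by exact_mod_cast hN
  linarith [Real.exp_one_lt_d9]

/-- Lower bound for a weighted lattice sum, coming from the lattice points close to a near-minimizer
of `H`. -/
lemma le_sum_weighted {N L : ℕ} (hN : 4 ≤ N) {ν : Finset ℕ} {u w HI cH ρ β m : ℝ} (hu : 0 ≤ u)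
    (huw : u < w) (hw : w ≤ 1) (hm : 0 ≤ m) (hβ : β ∈ Set.Icc 0 1) (hρ : 1 / 2 ≤ ρ) (hcH : 0 < cH)
    (hlen : 4 * ((L : ℝ) + 1) * (Real.log N) ^ 2 / N ≤ w - u)
    (hν : ∀ k : ℕ, k ∈ ν ↔ k + L ≤ N ∧ (k : ℝ) / N ∈ Set.Icc u w) {H G : ℝ → ℝ}
    (hG : ∀ t ∈ Set.Icc u w, m ≤ G t)
    (hHI' : ∀ ε > 0, ∃ t ∈ Set.Icc u w, H t < HI + ε)
    (hHol : ∀ t ∈ Set.Icc u w, ∀ s ∈ Set.Icc u w, |H t - H s| ≤ cH * |t - s| ^ ρ) :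
    m * Real.exp (-(1 + cH)) / 4 * (N * (w - u) / (Real.log N) ^ 2) ≤
      ∑ k ∈ ν, G ((k : ℝ) / N) * (N : ℝ) ^ (-(β * (H ((k : ℝ) / N) - HI))) := by
  have hN0 : (0 : ℝ) < N := by positivity
  set ℓ := Real.log N with hℓ
  have hℓ1 : 1 ≤ ℓ := one_le_log_natCast hN
  have hℓ0 : 0 < ℓ := by linarith
  set δ := (w - u) / ℓ ^ 2 with hδ
  have hδ0 : 0 < δ := div_pos (by linarith) (by positivity)
  have hδl : δ ≤ w - u := div_le_self (by linarith) (one_le_pow₀ hℓ1)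
  have hδρ : δ ^ ρ ≤ 1 / ℓ := by
    have h1 : δ ≤ ℓ ^ (-2 : ℝ) := by
      rw [hδ, Real.rpow_neg hℓ0.le, Real.rpow_two, ← one_div]
      exact div_le_div_of_nonneg_right (by linarith) (by positivity)
    calc δ ^ ρ ≤ (ℓ ^ (-2 : ℝ)) ^ ρ := Real.rpow_le_rpow hδ0.le h1 (by linarith)
      _ = ℓ ^ (-2 * ρ) := by rw [Real.rpow_mul hℓ0.le]
      _ ≤ ℓ ^ (-1 : ℝ) := Real.rpow_le_rpow_of_exponent_le hℓ1 (by linarith)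
      _ = 1 / ℓ := by rw [Real.rpow_neg_one, one_div]
  have hNδ : 4 * ((L : ℝ) + 1) ≤ N * δ := by
    rw [hδ, mul_div_assoc', le_div_iff₀ (by positivity)]
    rw [div_le_iff₀ hN0] at hlen
    linarith
  obtain ⟨t₀, ht₀, hHt₀⟩ := hHI' (1 / ℓ) (by positivity)
  obtain ⟨a, hau, hab, hat⟩ : ∃ a, u ≤ a ∧ a + δ / 2 ≤ w ∧
      ∀ t ∈ Set.Icc a (a + δ / 2), |t - t₀| ≤ δ := by
    rcases le_total u (t₀ - δ / 2) with h | h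
    · refine ⟨t₀ - δ / 2, h, by linarith [ht₀.2], fun t ht => abs_le.2 ⟨?_, ?_⟩⟩ <;>
        linarith [ht.1, ht.2]
    · refine ⟨t₀, ht₀.1, by linarith, fun t ht => abs_le.2 ⟨?_, ?_⟩⟩ <;>
        linarith [ht.1, ht.2]
  set μ := ν.filter fun k : ℕ => (k : ℝ) / N ∈ Set.Icc a (a + δ / 2) with hμ
  have hcard : N * δ / 4 ≤ μ.card := by
    have := sub_le_card_lattice (L := L) (N := N) (by omega) (ν := μ) (a := a) (b := a + δ / 2)
      (hu.trans hau) (fun k hk hk' => by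
        rw [hμ, Finset.mem_filter, hν]
        exact ⟨⟨hk, hau.trans hk'.1, hk'.2.trans hab⟩, hk'⟩) (hab.trans hw)
    linarith
  have hterm0 : ∀ k ∈ ν, 0 ≤ G ((k : ℝ) / N) * (N : ℝ) ^ (-(β * (H ((k : ℝ) / N) - HI))) :=
    fun k hk => mul_nonneg (hm.trans (hG _ ((hν k).1 hk).2)) (by positivity)
  have hterm : ∀ k ∈ μ, m * Real.exp (-(1 + cH)) ≤
      G ((k : ℝ) / N) * (N : ℝ) ^ (-(β * (H ((k : ℝ) / N) - HI))) := by
    intro k hk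
    rw [hμ, Finset.mem_filter] at hk
    have hkI := ((hν k).1 hk.1).2
    refine mul_le_mul (hG _ hkI) ?_ (Real.exp_pos _).le (hm.trans (hG _ hkI))
    rw [Real.rpow_def_of_pos hN0, ← hℓ]
    refine Real.exp_le_exp.2 ?_
    have h1 := (le_abs_self _).trans (hHol _ hkI _ ht₀)
    have h2 : |(k : ℝ) / N - t₀| ^ ρ ≤ 1 / ℓ :=
      (Real.rpow_le_rpow (abs_nonneg _) (hat _ hk.2) (by linarith)).trans hδρ
    have h3 : H ((k : ℝ) / N) - HI ≤ (1 + cH) * (1 / ℓ) := by nlinarith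
    have h4 : β * (H ((k : ℝ) / N) - HI) ≤ (1 + cH) * (1 / ℓ) := by
      calc β * (H ((k : ℝ) / N) - HI) ≤ β * ((1 + cH) * (1 / ℓ)) :=
            mul_le_mul_of_nonneg_left h3 hβ.1
        _ ≤ (1 + cH) * (1 / ℓ) := mul_le_of_le_one_left (by positivity) hβ.2
    have h5 : ℓ * (β * (H ((k : ℝ) / N) - HI)) ≤ 1 + cH := by
      calc _ ≤ ℓ * ((1 + cH) * (1 / ℓ)) := mul_le_mul_of_nonneg_left h4 hℓ0.le
        _ = 1 + cH := by field_simp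
    linarith
  calc m * Real.exp (-(1 + cH)) / 4 * (N * (w - u) / ℓ ^ 2)
      = N * δ / 4 * (m * Real.exp (-(1 + cH))) := by rw [hδ]; ring
    _ ≤ μ.card * (m * Real.exp (-(1 + cH))) := mul_le_mul_of_nonneg_right hcard (by positivity)
    _ = μ.card • (m * Real.exp (-(1 + cH))) := (nsmul_eq_mul _ _).symm
    _ ≤ ∑ k ∈ μ, G ((k : ℝ) / N) * (N : ℝ) ^ (-(β * (H ((k : ℝ) / N) - HI))) :=
        Finset.card_nsmul_le_sum _ _ _ hterm
    _ ≤ _ := Finset.sum_le_sum_of_subset_of_nonneg (Finset.filter_subset _ _)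
        fun k hk _ => hterm0 k hk

/-- Modulus of continuity of the summands at scale `1/N`. -/
lemma abs_weighted_sub_weighted_le {N : ℕ} (hN : 4 ≤ N) {HI cH ρ β M Λ x y gx gy : ℝ}
    (hβ : β ∈ Set.Icc 0 1) (hΛ : 0 ≤ Λ) (hx : HI ≤ x) (hy : HI ≤ y)
    (hgy : gy ∈ Set.Icc 0 M) (hg : |gx - gy| ≤ Λ * |x - y|) (hxy : |x - y| ≤ cH * (N : ℝ) ^ (-ρ)) :
    |gx * (2 * (N : ℝ)) ^ (-(β * (x - HI))) - gy * (2 * (N : ℝ)) ^ (-(β * (y - HI)))| ≤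
      (Λ + 4 * M) * cH * ((N : ℝ) ^ (-ρ) * Real.log N) := by
  have hN4 : (4 : ℝ) ≤ N := by exact_mod_cast hN
  have hℓ1 := one_le_log_natCast hN
  have hpow : ∀ z, HI ≤ z → (2 * (N : ℝ)) ^ (-(β * (z - HI))) ≤ 1 := fun z hz =>
    Real.rpow_le_one_of_one_le_of_nonpos (by linarith)
      (neg_nonpos.2 (mul_nonneg hβ.1 (by linarith)))
  have hlog : |Real.log (2 * N)| ≤ 2 * Real.log N := by
    rw [abs_of_nonneg (Real.log_nonneg (by linarith)), Real.log_mul (by norm_num) (by linarith)]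
    have : Real.log 2 ≤ Real.log N := Real.log_le_log (by norm_num) (by linarith)
    linarith
  have hM : 0 ≤ M := hgy.1.trans hgy.2
  have h1 := abs_rpow_sub_rpow_le (show (0 : ℝ) < 2 * N by linarith)
    (-(β * (x - HI))) (-(β * (y - HI)))
  have h2 : |(-(β * (x - HI))) - (-(β * (y - HI)))| ≤ |x - y| := by
    rw [show (-(β * (x - HI))) - (-(β * (y - HI))) = -(β * (x - y)) by ring, abs_neg, abs_mul,
      abs_of_nonneg hβ.1]
    exact mul_le_of_le_one_left (abs_nonneg _) hβ.2
  set X := (2 * (N : ℝ)) ^ (-(β * (x - HI)))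
  set Y := (2 * (N : ℝ)) ^ (-(β * (y - HI)))
  have hX0 : 0 ≤ X := by positivity
  have hY0 : 0 ≤ Y := by positivity
  have h3 : |X - Y| ≤ |x - y| * (4 * Real.log N) := by
    refine h1.trans (mul_le_mul h2 ?_ (by positivity) (abs_nonneg _))
    calc |Real.log (2 * N)| * (X + Y) ≤ 2 * Real.log N * (1 + 1) :=
          mul_le_mul hlog (add_le_add (hpow x hx) (hpow y hy)) (by positivity) (by linarith)
      _ = 4 * Real.log N := by ring
  calc |gx * X - gy * Y| = |(gx - gy) * X + gy * (X - Y)| := by ring_nf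
    _ ≤ |gx - gy| * X + gy * |X - Y| := by
        refine (abs_add_le _ _).trans (le_of_eq ?_)
        rw [abs_mul, abs_mul, abs_of_nonneg hX0, abs_of_nonneg hgy.1]
    _ ≤ Λ * |x - y| * 1 + M * (|x - y| * (4 * Real.log N)) :=
        add_le_add (mul_le_mul hg (hpow x hx) hX0 (by positivity))
          (mul_le_mul hgy.2 h3 (abs_nonneg _) hM)
    _ ≤ Λ * |x - y| * Real.log N + M * (|x - y| * (4 * Real.log N)) := by
        gcongr
    _ = (Λ + 4 * M) * Real.log N * |x - y| := by ring
    _ ≤ (Λ + 4 * M) * Real.log N * (cH * (N : ℝ) ^ (-ρ)) :=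
        mul_le_mul_of_nonneg_left hxy (by positivity)
    _ = _ := by ring

lemma one_sub_two_rpow_neg_le {β h : ℝ} (hβ : β ∈ Set.Icc 0 1) (hh : 0 ≤ h) :
    1 - (2 : ℝ) ^ (-(β * h)) ≤ h := by
  rw [Real.rpow_def_of_pos (by norm_num)]
  have h3 := Real.add_one_le_exp (Real.log 2 * -(β * h))
  have h4 : Real.log 2 ≤ 1 := by linarith [Real.log_two_lt_d9]
  have h6 : Real.log 2 * (β * h) ≤ h := by
    calc Real.log 2 * (β * h) ≤ 1 * (1 * h) := by
          gcongr
          · exact mul_nonneg hβ.1 hh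
          · exact hβ.2
      _ = h := by ring
  linarith

/-- The factor `2^{-βh}` is close to one where the weight `N^{-βh}` is not negligible. -/
lemma mul_rpow_mul_one_sub_le {N : ℕ} (hN : 4 ≤ N) {β h G M : ℝ} (hβ : β ∈ Set.Ioc 0 1)
    (hh : 0 ≤ h) (hG : G ∈ Set.Icc 0 M) :
    G * (N : ℝ) ^ (-(β * h)) * (1 - 2 ^ (-(β * h))) ≤
      G * (N : ℝ) ^ (-(β * h)) * (3 / β * (Real.log (Real.log N) / Real.log N)) +
        M * ((Real.log N) ^ 3)⁻¹ := by
  have hN0 : (0 : ℝ) < N := by positivity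
  have hℓ1 := one_le_log_natCast hN
  set ℓ := Real.log N with hℓ
  have hℓ0 : 0 < ℓ := by linarith
  have hM : 0 ≤ M := hG.1.trans hG.2
  have hβ0 := hβ.1
  have hll : 0 ≤ Real.log ℓ := Real.log_nonneg hℓ1
  have hW : 0 ≤ G * (N : ℝ) ^ (-(β * h)) := mul_nonneg hG.1 (by positivity)
  have h2 : (0 : ℝ) ≤ 2 ^ (-(β * h)) := by positivity
  have h2h := one_sub_two_rpow_neg_le (Set.Ioc_subset_Icc_self hβ) hh
  rcases le_total h (3 / β * (Real.log ℓ / ℓ)) with hc | hc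
  · have : 0 ≤ M * (ℓ ^ 3)⁻¹ := by positivity
    have := mul_le_mul_of_nonneg_left (h2h.trans hc) hW
    linarith
  · have h1 : (N : ℝ) ^ (-(β * h)) ≤ (ℓ ^ 3)⁻¹ := by
      rw [Real.rpow_def_of_pos hN0, ← hℓ, ← Real.exp_log (show 0 < (ℓ ^ 3)⁻¹ by positivity),
        Real.log_inv, Real.log_pow]
      refine Real.exp_le_exp.2 ?_
      have h3 : ℓ * (β * (3 / β * (Real.log ℓ / ℓ))) = 3 * Real.log ℓ := by
        field_simp
      have h4 : ℓ * (β * (3 / β * (Real.log ℓ / ℓ))) ≤ ℓ * (β * h) := by gcongr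
      push_cast
      linarith
    have h3 : G * (N : ℝ) ^ (-(β * h)) * (1 - 2 ^ (-(β * h))) ≤ G * (N : ℝ) ^ (-(β * h)) :=
      mul_le_of_le_one_right hW (by linarith)
    have h4 : G * (N : ℝ) ^ (-(β * h)) ≤ M * (ℓ ^ 3)⁻¹ :=
      mul_le_mul hG.2 h1 (by positivity) hM
    have h5 : 0 ≤ G * (N : ℝ) ^ (-(β * h)) * (3 / β * (Real.log ℓ / ℓ)) := by positivity
    linarith

lemma abs_ratio_sub_one_le {n n₂ S T A : ℝ} (hn : 0 ≤ n) (hn₂ : 0 < n₂) (hnn : n ≤ n₂) (hS : 0 < S)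
    (hA : A ≤ S) :
    |n / n₂ * (T / S) - 1| ≤ |T - 2 * A| / S + 2 * ((S - A) / S) + |n₂ - 2 * n| / n₂ := by
  have e : n / n₂ * (T / S) - 1 =
      n / n₂ * ((T - 2 * A) / S) - n / n₂ * (2 * ((S - A) / S)) - (n₂ - 2 * n) / n₂ := by
    field_simp
    ring
  have h0 : 0 ≤ n / n₂ := div_nonneg hn hn₂.le
  have h1 : n / n₂ ≤ 1 := (div_le_one hn₂).2 hnn
  have h2 : 0 ≤ 2 * ((S - A) / S) := mul_nonneg (by norm_num) (div_nonneg (by linarith) hS.le)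
  rw [e]
  refine (abs_sub _ _).trans (add_le_add ((abs_sub _ _).trans (add_le_add ?_ ?_)) ?_)
  · rw [abs_mul, abs_of_nonneg h0, abs_div, abs_of_pos hS]
    exact mul_le_of_le_one_left (by positivity) h1
  · rw [abs_mul, abs_of_nonneg h0, abs_of_nonneg h2]
    exact mul_le_of_le_one_left h2 h1
  · rw [abs_div, abs_of_pos hn₂]

lemma linear_combination_le_add_mul_add {a b c d x y z : ℝ} (ha : 0 ≤ a) (hb : 0 ≤ b) (hc : 0 ≤ c)
    (hd : 0 ≤ d) (hx : 0 ≤ x) (hy : 0 ≤ y) (hz : 0 ≤ z) :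
    c * z + b * y + 2 * (a * x) + d * z ≤ (2 * a + b + (c + d)) * (x + y + z) := by
  have h : 0 ≤ 2 * a * (y + z) + b * (x + z) + (c + d) * (x + y) := by positivity
  linarith

set_option maxHeartbeats 400000 in
/-- Bounds for the ratio of normalised sums, with `G` in place of the powers of the norms. -/
lemma exists_normalized_ratio_bounds {L : ℕ} (hL : 1 ≤ L) {H G : ℝ → ℝ} {cH ρ β m M Λ : ℝ}
    (hcH : 0 < cH) (hρ : ρ ∈ Set.Icc (1 / 2) 1) (hβ : β ∈ Set.Ioc 0 1) (hm : 0 < m) (hM : 0 < M)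
    (hΛ : 0 < Λ) (hH : ∀ t ∈ Set.Icc (0 : ℝ) 1, H t ≤ 1)
    (hHol : ∀ t ∈ Set.Icc (0 : ℝ) 1, ∀ s ∈ Set.Icc (0 : ℝ) 1, |H t - H s| ≤ cH * |t - s| ^ ρ)
    (hG : ∀ t ∈ Set.Icc (0 : ℝ) 1, m ≤ G t ∧ G t ≤ M)
    (hGL : ∀ t ∈ Set.Icc (0 : ℝ) 1, ∀ s ∈ Set.Icc (0 : ℝ) 1, |G t - G s| ≤ Λ * |H t - H s|) :
    ∃ c > 0, ∀ u w HI : ℝ, 0 ≤ u → u < w → w ≤ 1 → 0 ≤ HI → (∀ t ∈ Set.Icc u w, HI ≤ H t) →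
      (∀ ε > 0, ∃ t ∈ Set.Icc u w, H t < HI + ε) → ∀ N : ℕ, 4 ≤ N →
      4 * ((L : ℝ) + 1) * (Real.log N) ^ 2 / N ≤ w - u → ∀ ν ν₂ : Finset ℕ,
      (∀ k : ℕ, k ∈ ν ↔ k + L ≤ N ∧ (k : ℝ) / N ∈ Set.Icc u w) →
      (∀ m : ℕ, m ∈ ν₂ ↔ m + L ≤ 2 * N ∧ (m : ℝ) / (2 * N) ∈ Set.Icc u w) → ∀ S T X : ℝ,
      S = ∑ k ∈ ν, G ((k : ℝ) / N) * (N : ℝ) ^ (-(β * (H ((k : ℝ) / N) - HI))) →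
      T = ∑ m ∈ ν₂, G ((m : ℝ) / (2 * N)) *
        (2 * (N : ℝ)) ^ (-(β * (H ((m : ℝ) / (2 * N)) - HI))) →
      X = (ν.card : ℝ) / ν₂.card * (T / S) →
      |X - 1| ≤ c * (min (Real.log (Real.log N) / Real.log N) ((w - u) ^ ρ) +
        (N : ℝ) ^ (-(β * ρ)) * (Real.log N) ^ 3 + (w - u)⁻¹ * (N : ℝ)⁻¹ * (Real.log N) ^ 2) ∧
      1 / 6 ≤ X := by
  set c₁ : ℝ := m * Real.exp (-(1 + cH)) / 4 with hc₁
  set C₂ : ℝ := (Λ + 4 * M) * cH with hC₂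
  set ll₀ : ℝ := Real.log (Real.log 4) with hll₀
  have hc₁0 : 0 < c₁ := by positivity
  have hC₂0 : 0 < C₂ := by positivity
  have hβ0 := hβ.1
  have hβ' : β ∈ Set.Icc (0 : ℝ) 1 := Set.Ioc_subset_Icc_self hβ
  have hlog4 : 1 < Real.log 4 := by
    rw [Real.lt_log_iff_exp_lt (by norm_num)]
    linarith [Real.exp_one_lt_d9]
  have hll₀0 : 0 < ll₀ := Real.log_pos hlog4
  set C₃ : ℝ := cH + (3 / β + 2 * M / c₁ / ll₀) with hC₃
  have hC₃0 : 0 < C₃ := by positivity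
  refine ⟨2 * C₃ + 4 * C₂ / c₁ + ((L + 3) * M / c₁ + 2 * (L + 3)), by positivity, ?_⟩
  intro u w HI hu huw hw hHI0 hHI hHI' N hN hlen ν ν₂ hν hν₂ S T X hS hT hX
  have hN4 : (4 : ℝ) ≤ N := by exact_mod_cast hN
  have hN0 : (0 : ℝ) < N := by linarith
  have hℓ1 : 1 ≤ Real.log N := one_le_log_natCast hN
  have hllN : ll₀ ≤ Real.log (Real.log N) :=
    Real.log_le_log (by linarith) (Real.log_le_log (by norm_num) hN4)
  set ℓ := Real.log N with hℓ
  have hℓ0 : 0 < ℓ := by linarith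
  have hsub : ∀ t ∈ Set.Icc u w, t ∈ Set.Icc (0 : ℝ) 1 :=
    fun t ht => ⟨hu.trans ht.1, ht.2.trans hw⟩
  have hh1 : ∀ t ∈ Set.Icc u w, H t - HI ≤ 1 := fun t ht => by linarith [hH t (hsub t ht)]
  have hlam : 0 < w - u := by linarith
  have hL1 : (1 : ℝ) ≤ L := by exact_mod_cast hL
  set Z : ℝ := N * (w - u) with hZ
  have hZℓ : 4 * ((L : ℝ) + 1) * ℓ ^ 2 ≤ Z := by
    rw [div_le_iff₀ hN0] at hlen
    linarith
  have hℓ2 : 1 ≤ ℓ ^ 2 := one_le_pow₀ hℓ1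
  have hZL : 4 * ((L : ℝ) + 1) ≤ Z := le_trans (le_mul_of_one_le_right (by positivity) hℓ2) hZℓ
  have hZ0 : 0 < Z := by positivity
  set n : ℝ := (ν.card : ℝ) with hn
  set n₂ : ℝ := (ν₂.card : ℝ) with hn₂
  have hn_le : n ≤ 2 * Z := by
    have := card_lattice_le (by omega) hu huw.le (fun k hk => ((hν k).1 hk).2)
    linarith
  have hn_ge : Z / 2 ≤ n := by
    have := sub_le_card_lattice (by omega) hu (fun k h h' => (hν k).2 ⟨h, h'⟩) hw
    linarith
  have hcard : |n₂ - 2 * n| ≤ L + 3 := by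
    have := abs_sum_refined_sub_two_mul_sum_le (by omega) hL hu huw.le hν hν₂
      (p := fun _ => 1) (q := fun _ => 1) (B := 1) (D := 0) le_rfl (by simp) (by simp)
      zero_le_one (by simp)
    simpa using this
  have hcard' := abs_le.1 hcard
  have hnn : n ≤ n₂ := by linarith [hcard'.1]
  have hn0 : 0 < n := by linarith
  have hn₂0 : 0 < n₂ := by linarith
  set F : ℝ → ℝ := fun t => G t * (N : ℝ) ^ (-(β * (H t - HI))) with hF
  set P : ℝ → ℝ := fun t => G t * (2 * (N : ℝ)) ^ (-(β * (H t - HI))) with hP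
  have hG0 : ∀ t ∈ Set.Icc u w, 0 < G t := fun t ht => hm.trans_le (hG t (hsub t ht)).1
  have hF0 : ∀ t ∈ Set.Icc u w, 0 ≤ F t := fun t ht => mul_nonneg (hG0 t ht).le (by positivity)
  have hP0 : ∀ t ∈ Set.Icc u w, 0 ≤ P t := fun t ht => mul_nonneg (hG0 t ht).le (by positivity)
  have hPM : ∀ t ∈ Set.Icc u w, |P t| ≤ M := by
    intro t ht
    rw [abs_of_nonneg (hP0 t ht)]
    have h1 : (2 * (N : ℝ)) ^ (-(β * (H t - HI))) ≤ 1 :=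
      Real.rpow_le_one_of_one_le_of_nonpos (by linarith)
        (neg_nonpos.2 (mul_nonneg hβ0.le (by linarith [hHI t ht])))
    calc P t ≤ M * 1 := mul_le_mul (hG t (hsub t ht)).2 h1 (by positivity) hM.le
      _ = M := mul_one M
  have hPF : ∀ t, P t = F t * 2 ^ (-(β * (H t - HI))) := by
    intro t
    simp only [hP, hF]
    rw [Real.mul_rpow (by norm_num) hN0.le]
    ring
  have hS' : S = ∑ k ∈ ν, F ((k : ℝ) / N) := hS
  have hT' : T = ∑ k ∈ ν₂, P ((k : ℝ) / (2 * N)) := hT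
  set A := ∑ k ∈ ν, P ((k : ℝ) / N) with hA
  have hS_ge : c₁ * (Z / ℓ ^ 2) ≤ S := by
    rw [hS]
    exact le_sum_weighted hN hu huw hw hm.le hβ' hρ.1 hcH hlen hν
      (fun t ht => (hG t (hsub t ht)).1) hHI'
      (fun t ht s hs => hHol t (hsub t ht) s (hsub s hs))
  have hS0 : 0 < S := lt_of_lt_of_le (by positivity) hS_ge
  have hterm : ∀ t ∈ Set.Icc u w, P t ≤ F t ∧ F t / 2 ≤ P t := by
    intro t ht
    rw [hPF]
    have h0 : 0 ≤ β * (H t - HI) := mul_nonneg hβ0.le (by linarith [hHI t ht])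
    have h1 : β * (H t - HI) ≤ 1 := mul_le_one₀ hβ.2 (by linarith [hHI t ht]) (hh1 t ht)
    have h2 : (2 : ℝ) ^ (-(β * (H t - HI))) ≤ 1 :=
      Real.rpow_le_one_of_one_le_of_nonpos (by norm_num) (by linarith)
    have h3 : (2 : ℝ)⁻¹ ≤ (2 : ℝ) ^ (-(β * (H t - HI))) := by
      rw [← Real.rpow_neg_one]
      exact Real.rpow_le_rpow_of_exponent_le (by norm_num) (by linarith)
    have h4 := mul_le_mul_of_nonneg_left h3 (hF0 t ht)
    exact ⟨mul_le_of_le_one_right (hF0 t ht) h2, by linarith⟩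
  have hAS : A ≤ S := by
    rw [hS', hA]
    exact Finset.sum_le_sum fun k hk => (hterm _ ((hν k).1 hk).2).1
  have hA_ge : S / 2 ≤ A := by
    rw [hS', hA, Finset.sum_div]
    exact Finset.sum_le_sum fun k hk => (hterm _ ((hν k).1 hk).2).2
  have hAT : A ≤ T := by
    rw [hT', hA]
    exact sum_le_sum_refined hν hν₂ hP0
  have hSA : S - A = ∑ k ∈ ν, F ((k : ℝ) / N) * (1 - 2 ^ (-(β * (H ((k : ℝ) / N) - HI)))) := by
    rw [hS', hA, ← Finset.sum_sub_distrib]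
    exact Finset.sum_congr rfl fun k _ => by rw [hPF]; ring
  have bias₁ : S - A ≤ cH * (w - u) ^ ρ * S := by
    rw [hSA, hS', Finset.mul_sum]
    refine Finset.sum_le_sum fun k hk => ?_
    have ht := ((hν k).1 hk).2
    have h1 := one_sub_two_rpow_neg_le hβ' (show 0 ≤ H ((k : ℝ) / N) - HI by linarith [hHI _ ht])
    have h2 : H ((k : ℝ) / N) - HI ≤ cH * (w - u) ^ ρ := by
      refine le_of_forall_pos_lt_add fun ε hε => ?_
      obtain ⟨t₀, ht₀, hHt₀⟩ := hHI' ε hε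
      have h3 := (le_abs_self _).trans (hHol _ (hsub _ ht) _ (hsub _ ht₀))
      have h4 : |(k : ℝ) / N - t₀| ^ ρ ≤ (w - u) ^ ρ := by
        refine Real.rpow_le_rpow (abs_nonneg _) (abs_le.2 ⟨?_, ?_⟩) (by linarith [hρ.1]) <;>
          linarith [ht.1, ht.2, ht₀.1, ht₀.2]
      have h5 := mul_le_mul_of_nonneg_left h4 hcH.le
      linarith
    rw [mul_comm]
    exact mul_le_mul_of_nonneg_right (h1.trans h2) (hF0 _ ht)
  have bias₂ : S - A ≤ (3 / β + 2 * M / c₁ / ll₀) * (Real.log ℓ / ℓ) * S := by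
    have h1 : S - A ≤ 3 / β * (Real.log ℓ / ℓ) * S + n * (M * (ℓ ^ 3)⁻¹) := by
      rw [hSA, hS', Finset.mul_sum, hn, ← nsmul_eq_mul, ← Finset.sum_const,
        ← Finset.sum_add_distrib]
      refine Finset.sum_le_sum fun k hk => ?_
      have ht := ((hν k).1 hk).2
      refine (mul_rpow_mul_one_sub_le hN hβ (by linarith [hHI _ ht])
        ⟨(hG0 _ ht).le, (hG _ (hsub _ ht)).2⟩).trans (le_of_eq ?_)
      simp only [hF, ← hℓ]
      ring
    have h2 : n * (M * (ℓ ^ 3)⁻¹) ≤ 2 * M / c₁ / ll₀ * (Real.log ℓ / ℓ) * S := by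
      calc n * (M * (ℓ ^ 3)⁻¹) ≤ 2 * Z * (M * (ℓ ^ 3)⁻¹) := by gcongr
        _ = 2 * M / c₁ / ll₀ * (ll₀ / ℓ) * (c₁ * (Z / ℓ ^ 2)) := by field_simp
        _ ≤ 2 * M / c₁ / ll₀ * (Real.log ℓ / ℓ) * S := by
            have : 0 ≤ Real.log ℓ := hll₀0.le.trans hllN
            gcongr
    linarith
  have bias : (S - A) / S ≤ C₃ * min (Real.log ℓ / ℓ) ((w - u) ^ ρ) := by
    rw [div_le_iff₀ hS0]
    rcases min_choice (Real.log ℓ / ℓ) ((w - u) ^ ρ) with h | h <;> rw [h]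
    · refine bias₂.trans (mul_le_mul_of_nonneg_right (mul_le_mul_of_nonneg_right ?_ ?_) hS0.le)
      · linarith
      · exact div_nonneg (by linarith) hℓ0.le
    · refine bias₁.trans (mul_le_mul_of_nonneg_right (mul_le_mul_of_nonneg_right ?_ ?_) hS0.le)
      · have : 0 ≤ 3 / β + 2 * M / c₁ / ll₀ := by positivity
        linarith
      · positivity
  have hpair : |T - 2 * A| ≤ (L + 3) * M + 2 * n * (C₂ * ((N : ℝ) ^ (-ρ) * ℓ)) := by
    rw [hT', hA]
    refine abs_sum_refined_sub_two_mul_sum_le (by omega) hL hu huw.le hν hν₂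
      (p := fun k => P ((k : ℝ) / (2 * N))) (q := fun k => P ((k : ℝ) / N)) (by positivity)
      (fun k hk => hPM _ ((hν₂ k).1 hk).2) (fun k hk => hPM _ ((hν k).1 hk).2) hM.le ?_
    intro k hk hk'
    have ht := ((hν₂ k).1 hk).2
    have hs := ((hν _).1 hk').2
    refine abs_weighted_sub_weighted_le hN hβ' hΛ.le (hHI _ ht) (hHI _ hs)
      ⟨(hG0 _ hs).le, (hG _ (hsub _ hs)).2⟩ (hGL _ (hsub _ ht) _ (hsub _ hs)) ?_
    refine (hHol _ (hsub _ ht) _ (hsub _ hs)).trans (mul_le_mul_of_nonneg_left ?_ hcH.le)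
    rw [Real.rpow_neg hN0.le, ← Real.inv_rpow hN0.le]
    refine Real.rpow_le_rpow (abs_nonneg _) ?_ (by linarith [hρ.1])
    have hk2 : ((k / 2 : ℕ) : ℝ) * 2 ≤ k := by exact_mod_cast Nat.div_mul_le_self k 2
    have hk2' : (k : ℝ) ≤ ((k / 2 : ℕ) : ℝ) * 2 + 1 := by
      exact_mod_cast (show k ≤ k / 2 * 2 + 1 by omega)
    have e : (k : ℝ) / (2 * N) - ((k / 2 : ℕ) : ℝ) / N =
        (k - ((k / 2 : ℕ) : ℝ) * 2) / 2 * (N : ℝ)⁻¹ := by field_simp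
    rw [e, abs_mul, abs_of_pos (inv_pos.2 hN0)]
    refine mul_le_of_le_one_left (by positivity) (abs_le.2 ⟨?_, ?_⟩) <;> linarith
  have hpairS : |T - 2 * A| / S ≤
      (L + 3) * M / c₁ * (ℓ ^ 2 / Z) + 4 * C₂ / c₁ * ((N : ℝ) ^ (-(β * ρ)) * ℓ ^ 3) := by
    have hNρ : (N : ℝ) ^ (-ρ) ≤ (N : ℝ) ^ (-(β * ρ)) :=
      Real.rpow_le_rpow_of_exponent_le (by linarith)
        (neg_le_neg (mul_le_of_le_one_left (by linarith [hρ.1]) hβ.2))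
    rw [div_le_iff₀ hS0]
    calc |T - 2 * A| ≤ (L + 3) * M + 2 * n * (C₂ * ((N : ℝ) ^ (-ρ) * ℓ)) := hpair
      _ ≤ (L + 3) * M + 2 * (2 * Z) * (C₂ * ((N : ℝ) ^ (-(β * ρ)) * ℓ)) := by gcongr
      _ = ((L + 3) * M / c₁ * (ℓ ^ 2 / Z) + 4 * C₂ / c₁ * ((N : ℝ) ^ (-(β * ρ)) * ℓ ^ 3)) *
            (c₁ * (Z / ℓ ^ 2)) := by field_simp; ring
      _ ≤ _ := by gcongr
  have hcardS : |n₂ - 2 * n| / n₂ ≤ 2 * (L + 3) * (ℓ ^ 2 / Z) := by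
    rw [div_le_iff₀ hn₂0]
    calc |n₂ - 2 * n| ≤ L + 3 := hcard
      _ ≤ (L + 3) * ℓ ^ 2 := le_mul_of_one_le_right (by positivity) hℓ2
      _ = 2 * (L + 3) * (ℓ ^ 2 / Z) * (Z / 2) := by field_simp
      _ ≤ 2 * (L + 3) * (ℓ ^ 2 / Z) * n₂ := by
          have : Z / 2 ≤ n₂ := by linarith
          gcongr
  have hmin : 0 ≤ min (Real.log ℓ / ℓ) ((w - u) ^ ρ) :=
    le_min (div_nonneg (by linarith) hℓ0.le) (by positivity)
  have hZe : (w - u)⁻¹ * (N : ℝ)⁻¹ * ℓ ^ 2 = ℓ ^ 2 / Z := by rw [hZ]; field_simp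
  rw [hX, hZe]
  constructor
  · refine (abs_ratio_sub_one_le hn0.le hn₂0 hnn hS0 hAS).trans ?_
    have hy : 0 ≤ (N : ℝ) ^ (-(β * ρ)) * ℓ ^ 3 := by positivity
    have hz : 0 ≤ ℓ ^ 2 / Z := by positivity
    refine (add_le_add (add_le_add hpairS (mul_le_mul_of_nonneg_left bias zero_le_two))
      hcardS).trans ?_
    exact linear_combination_le_add_mul_add (by positivity) (by positivity) (by positivity)
      (by positivity) hmin hy hz
  · have h1 : 1 / 3 ≤ n / n₂ := by
      rw [le_div_iff₀ hn₂0]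
      linarith [hcard'.2]
    have h2 : 1 / 2 ≤ T / S := by
      rw [le_div_iff₀ hS0]
      linarith
    calc (1 / 6 : ℝ) = 1 / 3 * (1 / 2) := by norm_num
      _ ≤ _ := mul_le_mul h1 h2 (by norm_num) (by positivity)

/-- With `R_N(I) = (|ν_N(I)|/|ν_{2N}(I)|)·T_{2N}(I)/S_N(I)` (the
ratio `E(Ṽ_{2N}^β(I))/E(Ṽ_N^β(I))`) and
`T_N(μ,β) = min{(log log N)/log N, μ^{ρ_H}} + N^{−βρ_H}(log N)³ + μ^{−1}N^{−1}(log N)²`,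
there are constants `c, c', c'' > 0` (not depending on `I` and `N`) such that
for every compact interval `I = [u,w] ⊆ [0,1]` and every `N ≥ 4` with
`λ(I) ≥ 4(L+1)N^{−1}(log N)²`:
(i) `|2^{βH̲(I)}·R_N(I) − 1| ≤ c·T_N(λ(I),β)`;
(ii) `1/(2^{βH̲(I)}·R_N(I)) ≤ c'`;
(iii) `|1/(2^{βH̲(I)}·R_N(I)) − 1| ≤ c''·T_N(λ(I),β)`. -/
theorem expectation_ratio_convergence (α : ℝ)
    (hα : α ∈ Set.Ioo (1 : ℝ) 2) (L : ℕ) (hL : 2 ≤ L) (β : ℝ)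
    (hβ : β ∈ Set.Ioc (0 : ℝ) (1 / 4)) (Hlow Hup : ℝ) (h0 : 1 / α < Hlow)
    (h1 : Hlow ≤ Hup) (h2 : Hup < 1) (H : ℝ → ℝ)
    (hH : ∀ t ∈ Set.Icc (0 : ℝ) 1, H t ∈ Set.Icc Hlow Hup) (cH ρ : ℝ)
    (hcH : 0 < cH) (hρ0 : Hup < ρ) (hρ1 : ρ ≤ 1)
    (hHol : ∀ t₁ ∈ Set.Icc (0 : ℝ) 1, ∀ t₂ ∈ Set.Icc (0 : ℝ) 1,
      |H t₁ - H t₂| ≤ cH * |t₁ - t₂| ^ ρ) :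
    ∃ c > (0 : ℝ), ∃ c' > (0 : ℝ), ∃ c'' > (0 : ℝ),
      ∀ u w : ℝ, 0 ≤ u → u < w → w ≤ 1 → ∀ N : ℕ, 4 ≤ N →
      4 * ((L : ℝ) + 1) * (Real.log N) ^ 2 / N ≤ w - u →
      let ν : Finset ℕ :=
        (Finset.range (N - L + 1)).filter fun k => (k : ℝ) / N ∈ Set.Icc u w
      let ν2 : Finset ℕ :=
        (Finset.range (2 * N - L + 1)).filter fun m =>
          (m : ℝ) / (2 * N) ∈ Set.Icc u w
      let S := ∑ k ∈ ν, PhiNorm α L (H ((k : ℝ) / N)) ^ β *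
        (N : ℝ) ^ (-(β * H ((k : ℝ) / N)))
      let T := ∑ m ∈ ν2, PhiNorm α L (H ((m : ℝ) / (2 * N))) ^ β *
        (2 * (N : ℝ)) ^ (-(β * H ((m : ℝ) / (2 * N))))
      let HI := sInf (H '' Set.Icc u w)
      let R := ((ν.card : ℝ) / (ν2.card : ℝ)) * (T / S)
      let TN := min (Real.log (Real.log N) / Real.log N) ((w - u) ^ ρ) +
        (N : ℝ) ^ (-(β * ρ)) * (Real.log N) ^ 3 +
        (w - u)⁻¹ * (N : ℝ)⁻¹ * (Real.log N) ^ 2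
      |(2 : ℝ) ^ (β * HI) * R - 1| ≤ c * TN ∧
      1 / ((2 : ℝ) ^ (β * HI) * R) ≤ c' ∧
      |1 / ((2 : ℝ) ^ (β * HI) * R) - 1| ≤ c'' * TN := by
  have hα0 : 0 < α := by linarith [hα.1]
  have hαi : 1 / 2 < 1 / α := one_div_lt_one_div_of_lt hα0 hα.2
  have hL1 : 1 ≤ L := by omega
  have hβ1 : β ∈ Set.Ioc (0 : ℝ) 1 := ⟨hβ.1, by linarith [hβ.2]⟩
  obtain ⟨m, hm, M, hM, Λ, hΛ, hg⟩ := exists_PhiNorm_rpow_bounds hα.1 hL1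
    (Set.Ioc_subset_Icc_self hβ1) h0 h1 h2
  obtain ⟨c, hc, hmain⟩ := exists_normalized_ratio_bounds (L := L) hL1 (H := H)
    (G := fun t => PhiNorm α L (H t) ^ β) (cH := cH) (ρ := ρ) (β := β) hcH
    ⟨by linarith, hρ1⟩ hβ1 hm hM hΛ (fun t ht => (hH t ht).2.trans h2.le) hHol
    (fun t ht => ⟨(hg _ (hH t ht) _ (hH t ht)).1, (hg _ (hH t ht) _ (hH t ht)).2.1⟩)
    (fun t ht s hs => (hg _ (hH t ht) _ (hH s hs)).2.2)
  refine ⟨c, hc, 6, by norm_num, 6 * c, by positivity, ?_⟩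
  intro u w hu huw hw N hN hlen ν ν2 S T HI R TN
  have hN0 : (0 : ℝ) < N := by positivity
  have hsub : Set.Icc u w ⊆ Set.Icc (0 : ℝ) 1 := Set.Icc_subset_Icc hu hw
  have hne : (H '' Set.Icc u w).Nonempty := (Set.nonempty_Icc.2 huw.le).image H
  have hlow : ∀ y ∈ H '' Set.Icc u w, Hlow ≤ y := by
    rintro _ ⟨t, ht, rfl⟩
    exact (hH t (hsub ht)).1
  have hLN : L ≤ N := by
    have h3 : 1 ≤ Real.log N ^ 2 := one_le_pow₀ (one_le_log_natCast hN)
    rw [div_le_iff₀ hN0] at hlen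
    have h4 : 4 * ((L : ℝ) + 1) ≤ 4 * ((L : ℝ) + 1) * Real.log N ^ 2 :=
      le_mul_of_one_le_right (by positivity) h3
    have h5 : (w - u) * N ≤ 1 * N := by gcongr; linarith
    have h6 : (L : ℝ) ≤ N := by linarith [(Nat.cast_nonneg L : (0 : ℝ) ≤ L)]
    exact_mod_cast h6
  have hSnorm : S = (N : ℝ) ^ (-(β * HI)) * ∑ k ∈ ν, PhiNorm α L (H ((k : ℝ) / N)) ^ β *
      (N : ℝ) ^ (-(β * (H ((k : ℝ) / N) - HI))) := by
    rw [Finset.mul_sum]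
    refine Finset.sum_congr rfl fun k _ => ?_
    rw [mul_left_comm, ← Real.rpow_add hN0]
    ring_nf
  have hTnorm : (2 : ℝ) ^ (β * HI) * T = (N : ℝ) ^ (-(β * HI)) *
      ∑ m ∈ ν2, PhiNorm α L (H ((m : ℝ) / (2 * N))) ^ β *
        (2 * (N : ℝ)) ^ (-(β * (H ((m : ℝ) / (2 * N)) - HI))) := by
    have e : (N : ℝ) ^ (-(β * HI)) = 2 ^ (β * HI) * (2 * (N : ℝ)) ^ (-(β * HI)) := by
      rw [Real.mul_rpow (by norm_num) hN0.le, ← mul_assoc, ← Real.rpow_add (by norm_num),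
        add_neg_cancel, Real.rpow_zero, one_mul]
    rw [e, mul_assoc, Finset.mul_sum (a := (2 * (N : ℝ)) ^ (-(β * HI)))]
    congr 1
    refine Finset.sum_congr rfl fun k _ => ?_
    rw [mul_left_comm, ← Real.rpow_add (by positivity)]
    ring_nf
  have hX : (2 : ℝ) ^ (β * HI) * R = (ν.card : ℝ) / ν2.card * (
      (∑ m ∈ ν2, PhiNorm α L (H ((m : ℝ) / (2 * N))) ^ β *
        (2 * (N : ℝ)) ^ (-(β * (H ((m : ℝ) / (2 * N)) - HI)))) /
      ∑ k ∈ ν, PhiNorm α L (H ((k : ℝ) / N)) ^ β *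
        (N : ℝ) ^ (-(β * (H ((k : ℝ) / N) - HI)))) := by
    calc (2 : ℝ) ^ (β * HI) * R = (ν.card : ℝ) / ν2.card * ((2 : ℝ) ^ (β * HI) * T / S) := by
          simp only [R]; ring
      _ = _ := by rw [hTnorm, hSnorm, mul_div_mul_left _ _ (by positivity)]
  obtain ⟨hi, hii⟩ := hmain u w HI hu huw hw
    ((by linarith : (0 : ℝ) ≤ Hlow).trans (le_csInf hne hlow))
    (fun t ht => csInf_le ⟨Hlow, hlow⟩ ⟨t, ht, rfl⟩)
    (fun ε hε => by
      obtain ⟨_, ⟨t, ht, rfl⟩, h⟩ := exists_lt_of_csInf_lt hne (lt_add_of_pos_right HI hε)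
      exact ⟨t, ht, h⟩)
    N hN hlen ν ν2
    (fun k => by
      simp only [ν, Finset.mem_filter, Finset.mem_range]
      exact and_congr_left' (by omega))
    (fun k => by
      simp only [ν2, Finset.mem_filter, Finset.mem_range]
      exact and_congr_left' (by omega))
    _ _ _ rfl rfl hX
  have hpos : 0 < (2 : ℝ) ^ (β * HI) * R := by linarith
  have hinv : 1 / ((2 : ℝ) ^ (β * HI) * R) ≤ 6 := by
    rw [div_le_iff₀ hpos]
    linarith
  refine ⟨hi, hinv, ?_⟩
  have e : 1 / ((2 : ℝ) ^ (β * HI) * R) - 1 =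
      1 / ((2 : ℝ) ^ (β * HI) * R) * -((2 : ℝ) ^ (β * HI) * R - 1) := by
    rw [mul_neg, mul_sub, one_div_mul_cancel hpos.ne']
    ring
  rw [e, abs_mul, abs_neg, abs_of_pos (one_div_pos.2 hpos), mul_assoc]
  exact mul_le_mul hinv hi (abs_nonneg _) (by norm_num)
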